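/- Let N ≥ 1, J = ⌊(N+1)/2⌋, let ψ : ℂ → ℝ, let P = {P₁,…,P_N} be a complete set of monic polynomials, and let L+2M = N with K = ⌊(L+1)/2⌋. Let R be the 2J×2J antisymmetric matrix with R[j,k] = ⟨P_j,P_k⟩_ℝ if j,k ≤ N and R[j,k] = sgn(k−j)·∫_ℝ φ(α) P_{min(j,k)}(α) dα otherwise. Then for every t ∈ I_{2M}^N, assuming absolute integrability, (1/L!) ∫_{ℝ^L} {∏_{ℓ=1}^L φ(α_ℓ)} · Pf T^α · det W^α_{i',t'} dλ_L(α) = Pf R_{t_∘'}, where W^α_{i',t'} is the L×L minor with entries P_{t'(k)}(α_j) (rows indexed by the last L rows of the matrix [P_k(γ_j)], i.e. by α). -/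

import Mathlib

open MeasureTheory Finset

noncomputable section

/-- Pfaffian of a `2J × 2J` matrix, via the sum over the symmetric group. -/
def pf {K : Type*} [Field K] {J : ℕ} (U : Matrix (Fin (2*J)) (Fin (2*J)) K) : K :=
  ((2:K)^J * (Nat.factorial J : K))⁻¹ *
    ∑ τ : Equiv.Perm (Fin (2*J)), ((Equiv.Perm.sign τ : ℤ) : K) *
      ∏ j : Fin J, U (τ ⟨2*(j:ℕ), by have := j.isLt; omega⟩)
                     (τ ⟨2*(j:ℕ)+1, by have := j.isLt; omega⟩)

/-- The complementary error function `erfc(x) = (2/√π) ∫_x^∞ e^{-t²} dt`. -/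
def erfc (x : ℝ) : ℝ := (2 / Real.sqrt Real.pi) * ∫ t in Set.Ioi x, Real.exp (-t^2)

/-- The weight `φ(γ) = exp(-γ²/2) (erfc(√2 |Im γ|))^{1/2} ψ(γ)`. -/
def phi (ψ : ℂ → ℝ) (γ : ℂ) : ℂ :=
  Complex.exp (-γ^2/2) * ((erfc (Real.sqrt 2 * |γ.im|) ^ (1/2 : ℝ) : ℝ) : ℂ) * (ψ γ : ℂ)

/-- The skew-symmetric inner product
`⟨P,Q⟩_ℝ = ∫_{ℝ²} φ(α₁)φ(α₂) P(α₁)Q(α₂) sgn(α₂−α₁) dα₁dα₂`. -/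
def innerR (ψ : ℂ → ℝ) (P Q : Polynomial ℂ) : ℂ :=
  ∫ a : ℝ × ℝ, phi ψ (a.1 : ℂ) * phi ψ (a.2 : ℂ) * P.eval (a.1 : ℂ) * Q.eval (a.2 : ℂ) *
    ((Real.sign (a.2 - a.1) : ℝ) : ℂ)

/-- The `2K × 2K` antisymmetric matrix `T^α`, `K = ⌊(L+1)/2⌋` (`0`-based indices). -/
def Tmat {L : ℕ} (α : Fin L → ℝ) : Matrix (Fin (2*((L+1)/2))) (Fin (2*((L+1)/2))) ℝ :=
  fun j k => if h : (j:ℕ) < L ∧ (k:ℕ) < L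
    then Real.sign (α ⟨(k:ℕ), h.2⟩ - α ⟨(j:ℕ), h.1⟩)
    else Real.sign (((k:ℕ):ℝ) - ((j:ℕ):ℝ))

/-- The `2J × 2J` antisymmetric matrix `R`, `J = ⌊(N+1)/2⌋` (`0`-based indices; `P n`
is the monic polynomial of degree `n`, the paper's `P_{n+1}`). -/
def Rmat (N : ℕ) (ψ : ℂ → ℝ) (P : ℕ → Polynomial ℂ) :
    Matrix (Fin (2*((N+1)/2))) (Fin (2*((N+1)/2))) ℂ :=
  fun j k =>
    if (j:ℕ) < N ∧ (k:ℕ) < N then innerR ψ (P (j:ℕ)) (P (k:ℕ))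
    else ((Real.sign (((k:ℕ):ℝ) - ((j:ℕ):ℝ)) : ℝ) : ℂ) *
      ∫ a : ℝ, phi ψ (a:ℂ) * (P (min (j:ℕ) (k:ℕ))).eval (a:ℂ)

lemma aux_e_bij (K : ℕ) : Function.Bijective (fun x : Fin K ⊕ Fin K => (match x with
    | Sum.inl j => ⟨2*(j:ℕ), by have := j.isLt; omega⟩
    | Sum.inr j => ⟨2*(j:ℕ)+1, by have := j.isLt; omega⟩ : Fin (2*K))) := by
  rw [Fintype.bijective_iff_injective_and_card]
  constructor
  · rintro (a | a) (b | b) h <;> simp [Fin.ext_iff] at h ⊢ <;> omega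
  · simp; omega

lemma aux_fubini (K : ℕ) (τ : Equiv.Perm (Fin (2*K))) (G : Fin K → ℝ × ℝ → ℂ) :
    ∫ a : Fin (2*K) → ℝ, ∏ j : Fin K, G j (a (τ ⟨2*(j:ℕ), by have := j.isLt; omega⟩),
      a (τ ⟨2*(j:ℕ)+1, by have := j.isLt; omega⟩)) = ∏ j, ∫ p, G j p := by
  rw [← integral_fintype_prod_volume_eq_prod]
  let e : Fin K ⊕ Fin K ≃ Fin (2*K) := (Equiv.ofBijective _ (aux_e_bij K)).trans τ
  have h1 : MeasurePreserving (MeasurableEquiv.arrowProdEquivProdArrow ℝ ℝ (Fin K)) volume volume :=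
    measurePreserving_arrowProdEquivProdArrow ℝ ℝ (Fin K) (fun _ => volume) (fun _ => volume)
  have h2 := volume_measurePreserving_sumPiEquivProdPi_symm (fun _ : Fin K ⊕ Fin K => ℝ)
  have h3 := volume_measurePreserving_piCongrLeft (fun _ : Fin (2*K) => ℝ) e
  rw [← h3.integral_comp' , ← h2.integral_comp', ← h1.integral_comp']
  congr 1
  ext x
  refine Finset.prod_congr rfl fun j _ => ?_
  have e1 : τ ⟨2*(j:ℕ), by have := j.isLt; omega⟩ = e (Sum.inl j) := rfl
  have e2 : τ ⟨2*(j:ℕ)+1, by have := j.isLt; omega⟩ = e (Sum.inr j) := rfl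
  rw [e1, e2, MeasurableEquiv.piCongrLeft_apply_apply, MeasurableEquiv.piCongrLeft_apply_apply]
  rfl

lemma aux_ext (L n : ℕ) (hLn : L ≤ n) (hn : n = L ∨ n = L + 1) (F : (Fin L → ℝ) → ℂ) :
    ∫ a, F a = ∫ a : Fin n → ℝ, F (fun i => a (Fin.castLE hLn i)) *
      ∏ i : Fin n, (if (i:ℕ) < L then 1 else (Set.Icc (0:ℝ) 1).indicator 1 (a i)) := by
  rcases hn with rfl | rfl
  · simp
  · have h1 := volume_preserving_piFinSuccAbove (fun _ : Fin (L+1) => ℝ) (Fin.last L)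
    rw [← h1.symm.integral_comp']
    have : ∀ p : ℝ × (Fin L → ℝ), F (fun i => ((MeasurableEquiv.piFinSuccAbove
        (fun _ : Fin (L+1) => ℝ) (Fin.last L)).symm p) (Fin.castLE hLn i)) *
        (∏ i : Fin (L+1), (if (i:ℕ) < L then 1 else (Set.Icc (0:ℝ) 1).indicator 1
          (((MeasurableEquiv.piFinSuccAbove
        (fun _ : Fin (L+1) => ℝ) (Fin.last L)).symm p) i)))
        = (Set.Icc (0:ℝ) 1).indicator (1 : ℝ → ℂ) p.1 * F p.2 := by
      intro p
      have hc : ∀ i : Fin L, Fin.castLE hLn i = (Fin.last L).succAbove i := by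
        intro i; simp [Fin.ext_iff]
      simp only [hc, Fin.prod_univ_castSucc, MeasurableEquiv.piFinSuccAbove_symm_apply]
      simp [Fin.insertNthEquiv, mul_comm]
    simp_rw [this]
    rw [Measure.volume_eq_prod, integral_prod_mul]
    have : ∫ x, (Set.Icc (0:ℝ) 1).indicator (1 : ℝ → ℂ) x = 1 := by
      rw [integral_indicator measurableSet_Icc]; simp
    rw [this, one_mul]

def fext {L n : ℕ} (f : Fin L → ℝ → ℂ) (i : Fin n) : ℝ → ℂ :=
  if h : (i:ℕ) < L then f ⟨i, h⟩ else (Set.Icc (0:ℝ) 1).indicator 1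

def Sk (L : ℕ) {n : ℕ} (i j : Fin n) (x y : ℝ) : ℂ :=
  if (i:ℕ) < L ∧ (j:ℕ) < L then ((Real.sign (y - x) : ℝ) : ℂ)
    else ((Real.sign (((j:ℕ):ℝ) - ((i:ℕ):ℝ)) : ℝ) : ℂ)

lemma fext_int {L n : ℕ} (f : Fin L → ℝ → ℂ) (hf : ∀ i, Integrable (f i)) (i : Fin n) :
    Integrable (fext f i) := by
  unfold fext
  split_ifs
  · exact hf _
  · rw [integrable_indicator_iff measurableSet_Icc]
    exact integrableOn_const (by simp)

lemma sign_meas : Measurable Real.sign := by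
  unfold Real.sign
  exact Measurable.ite measurableSet_Iio measurable_const
    (Measurable.ite measurableSet_Ioi measurable_const measurable_const)

lemma sign_bd (x : ℝ) : ‖((Real.sign x : ℝ) : ℂ)‖ ≤ 1 := by
  rcases Real.sign_apply_eq x with h | h | h <;> simp [h]

lemma Sk_bd (L : ℕ) {n : ℕ} (i j : Fin n) (x y : ℝ) : ‖Sk L i j x y‖ ≤ 1 := by
  unfold Sk
  split_ifs <;> exact sign_bd _

lemma Sk_meas (L : ℕ) {n : ℕ} (i j : Fin n) : Measurable (fun p : ℝ × ℝ => Sk L i j p.1 p.2) := by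
  unfold Sk
  split_ifs
  · exact Complex.measurable_ofReal.comp (sign_meas.comp (by fun_prop))
  · exact measurable_const

def hatσ {L n : ℕ} (hLn : L ≤ n) (σ : Equiv.Perm (Fin L)) : Equiv.Perm (Fin n) :=
  σ.viaFintypeEmbedding (Fin.castLEEmb hLn)

lemma hatσ_sign {L n : ℕ} (hLn : L ≤ n) (σ : Equiv.Perm (Fin L)) :
    Equiv.Perm.sign (hatσ hLn σ) = Equiv.Perm.sign σ := Equiv.Perm.viaFintypeEmbedding_sign _ _

lemma hatσ_lt {L n : ℕ} (hLn : L ≤ n) (σ : Equiv.Perm (Fin L)) (i : Fin L) :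
    hatσ hLn σ (Fin.castLE hLn i) = Fin.castLE hLn (σ i) :=
  Equiv.Perm.viaFintypeEmbedding_apply_image σ (Fin.castLEEmb hLn) i

lemma hatσ_ge {L n : ℕ} (hLn : L ≤ n) (σ : Equiv.Perm (Fin L)) (i : Fin n) (hi : ¬ (i:ℕ) < L) :
    hatσ hLn σ i = i := by
  apply Equiv.Perm.viaFintypeEmbedding_apply_notMem_range
  rintro ⟨j, rfl⟩
  exact hi (by simp)

lemma Sk_hat {L n : ℕ} (hLn : L ≤ n) (hn : n = L ∨ n = L + 1) (σ : Equiv.Perm (Fin L))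
    (i j : Fin n) : Sk L (hatσ hLn σ i) (hatσ hLn σ j) = Sk L i j := by
  have key : ∀ i : Fin n, ((i:ℕ) < L ∧ (hatσ hLn σ i : ℕ) < L) ∨
      ((i:ℕ) = L ∧ (hatσ hLn σ i : ℕ) = L) := by
    intro i
    by_cases hi : (i:ℕ) < L
    · left
      refine ⟨hi, ?_⟩
      have := hatσ_lt hLn σ ⟨i, hi⟩
      rw [show Fin.castLE hLn ⟨i, hi⟩ = i from rfl] at this
      rw [this]; simp
    · right
      rw [hatσ_ge hLn σ i hi]
      omega
  ext x y
  unfold Sk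
  rcases key i with ⟨h1, h2⟩ | ⟨h1, h2⟩ <;> rcases key j with ⟨h3, h4⟩ | ⟨h3, h4⟩
  · simp [h1, h2, h3, h4]
  · have : (0:ℝ) < (L:ℝ) - ((i:ℕ):ℝ) := by rw [sub_pos]; exact_mod_cast h1
    have : (0:ℝ) < (L:ℝ) - ((hatσ hLn σ i:ℕ):ℝ) := by rw [sub_pos]; exact_mod_cast h2
    simp [h3, h4, Real.sign_of_pos, *]
  · have : ((j:ℕ):ℝ) - (L:ℝ) < 0 := by rw [sub_neg]; exact_mod_cast h3
    have : ((hatσ hLn σ j:ℕ):ℝ) - (L:ℝ) < 0 := by rw [sub_neg]; exact_mod_cast h4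
    simp [h1, h2, Real.sign_of_neg, *]
  · simp [h1, h2, h3, h4]

def Rk {L n : ℕ} (f : Fin L → ℝ → ℂ) (i j : Fin n) : ℂ :=
  ∫ p : ℝ × ℝ, fext f i p.1 * fext f j p.2 * Sk L i j p.1 p.2

lemma prod_pairs {K : ℕ} (τ : Equiv.Perm (Fin (2*K))) (g : Fin (2*K) → ℂ) :
    ∏ i, g i = ∏ j : Fin K, (g (τ ⟨2*(j:ℕ), by have := j.isLt; omega⟩) *
      g (τ ⟨2*(j:ℕ)+1, by have := j.isLt; omega⟩)) := by
  rw [← ((Equiv.ofBijective _ (aux_e_bij K)).trans τ).prod_comp, Fintype.prod_sum_type,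
    ← Finset.prod_mul_distrib]
  rfl

/-- the basic term -/
def term {L K : ℕ} (hLn : L ≤ 2*K) (f : Fin L → ℝ → ℂ) (σ : Equiv.Perm (Fin L))
    (τ : Equiv.Perm (Fin (2*K))) (a : Fin (2*K) → ℝ) : ℂ :=
  (∏ i, fext f (hatσ hLn σ i) (a i)) * ∏ j : Fin K,
    Sk L (τ ⟨2*(j:ℕ), by have := j.isLt; omega⟩) (τ ⟨2*(j:ℕ)+1, by have := j.isLt; omega⟩)
      (a (τ ⟨2*(j:ℕ), by have := j.isLt; omega⟩)) (a (τ ⟨2*(j:ℕ)+1, by have := j.isLt; omega⟩))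

lemma term_integral {L K : ℕ} (hLn : L ≤ 2*K) (hn : 2*K = L ∨ 2*K = L + 1)
    (f : Fin L → ℝ → ℂ) (σ : Equiv.Perm (Fin L)) (τ : Equiv.Perm (Fin (2*K))) :
    ∫ a, term hLn f σ τ a = ∏ j : Fin K,
      Rk f ((hatσ hLn σ * τ) ⟨2*(j:ℕ), by have := j.isLt; omega⟩)
        ((hatσ hLn σ * τ) ⟨2*(j:ℕ)+1, by have := j.isLt; omega⟩) := by
  unfold Rk
  rw [← aux_fubini K τ]
  congr 1
  ext a
  unfold term
  rw [prod_pairs τ, ← Finset.prod_mul_distrib]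
  simp only [Equiv.Perm.mul_apply, Sk_hat hLn hn]

lemma term_integrable {L K : ℕ} (hLn : L ≤ 2*K)
    (f : Fin L → ℝ → ℂ) (hf : ∀ i, Integrable (f i))
    (σ : Equiv.Perm (Fin L)) (τ : Equiv.Perm (Fin (2*K))) :
    Integrable (term hLn f σ τ) := by
  unfold term
  refine Integrable.mul_bdd (c := 1) ?_ ?_ ?_
  · exact Integrable.fintype_prod (fun i => fext_int f hf _)
  · apply Measurable.aestronglyMeasurable
    refine Finset.measurable_fun_prod _ fun j _ => ?_
    exact (Sk_meas L _ _).comp (f := fun a : Fin (2*K) → ℝ =>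
      (a (τ ⟨2*(j:ℕ), by have := j.isLt; omega⟩), a (τ ⟨2*(j:ℕ)+1, by have := j.isLt; omega⟩)))
      (by fun_prop)
  · refine Filter.Eventually.of_forall fun a => ?_
    rw [norm_prod]
    exact Finset.prod_le_one (fun _ _ => norm_nonneg _) (fun _ _ => Sk_bd _ _ _ _ _)

lemma prod_fext {L n : ℕ} (hLn : L ≤ n) (hn : n = L ∨ n = L + 1) (f : Fin L → ℝ → ℂ)
    (σ : Equiv.Perm (Fin L)) (a : Fin n → ℝ) :
    ∏ i, fext f (hatσ hLn σ i) (a i) = (∏ i, f (σ i) (a (Fin.castLE hLn i))) *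
      ∏ i : Fin n, (if (i:ℕ) < L then 1 else (Set.Icc (0:ℝ) 1).indicator 1 (a i)) := by
  have h1 : ∀ i : Fin L, fext f (hatσ hLn σ (Fin.castLE hLn i)) = f (σ i) := by
    intro i
    rw [hatσ_lt]
    simp [fext]
  rcases hn with rfl | rfl
  · simp only [Fin.is_lt, if_true, Finset.prod_const_one, mul_one]
    exact Finset.prod_congr rfl fun i _ => by rw [← h1 i]; rfl
  · rw [Fin.prod_univ_castSucc, Fin.prod_univ_castSucc]
    have h2 : fext f (hatσ hLn σ (Fin.last L)) = (Set.Icc (0:ℝ) 1).indicator 1 := by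
      rw [hatσ_ge _ _ _ (by simp)]
      simp [fext]
    rw [h2]
    simp only [Fin.val_castSucc, Fin.is_lt, if_true, Finset.prod_const_one, one_mul,
      Fin.val_last, lt_irrefl, if_false]
    congr 1
    exact Finset.prod_congr rfl fun i _ => by rw [← h1 i]; rfl

lemma pf_T {L : ℕ} (hLn : L ≤ 2*((L+1)/2)) (a : Fin (2*((L+1)/2)) → ℝ) :
    ((pf (Tmat (fun i => a (Fin.castLE hLn i))) : ℝ) : ℂ) =
    ((2:ℂ)^((L+1)/2) * (Nat.factorial ((L+1)/2) : ℂ))⁻¹ *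
    ∑ τ : Equiv.Perm (Fin (2*((L+1)/2))), ((Equiv.Perm.sign τ : ℤ) : ℂ) *
      ∏ j : Fin ((L+1)/2), Sk L (τ ⟨2*(j:ℕ), by have := j.isLt; omega⟩)
        (τ ⟨2*(j:ℕ)+1, by have := j.isLt; omega⟩) (a (τ ⟨2*(j:ℕ), by have := j.isLt; omega⟩))
        (a (τ ⟨2*(j:ℕ)+1, by have := j.isLt; omega⟩)) := by
  have hT : ∀ i j, ((Tmat (fun i => a (Fin.castLE hLn i)) i j : ℝ) : ℂ) =
      Sk L i j (a i) (a j) := by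
    intro i j
    unfold Tmat Sk
    split_ifs <;> rfl
  unfold pf
  push_cast
  simp only [hT]

lemma core (L : ℕ) (φ : ℝ → ℂ) (p : Fin L → ℝ → ℂ) (hf : ∀ i, Integrable (fun x => φ x * p i x)) :
    ((Nat.factorial L : ℕ) : ℂ)⁻¹ *
      (∫ a : Fin L → ℝ, (∏ ℓ : Fin L, φ (a ℓ)) * ((pf (Tmat a) : ℝ) : ℂ) *
          Matrix.det (Matrix.of fun j k : Fin L => p k (a j))) =
    pf (J := (L+1)/2) (Rk (fun i x => φ x * p i x)) := by
  have hLn : L ≤ 2*((L+1)/2) := by omega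
  have hn : 2*((L+1)/2) = L ∨ 2*((L+1)/2) = L + 1 := by omega
  set f : Fin L → ℝ → ℂ := fun i x => φ x * p i x with hfdef
  rw [aux_ext L _ hLn hn]
  have hpt : ∀ a : Fin (2*((L+1)/2)) → ℝ,
      ((∏ ℓ : Fin L, φ (a (Fin.castLE hLn ℓ))) *
        ((pf (Tmat (fun i => a (Fin.castLE hLn i))) : ℝ) : ℂ) *
          Matrix.det (Matrix.of fun j k : Fin L => p k (a (Fin.castLE hLn j)))) *
      ∏ i : Fin (2*((L+1)/2)), (if (i:ℕ) < L then 1 else (Set.Icc (0:ℝ) 1).indicator 1 (a i))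
      = ((2:ℂ)^((L+1)/2) * (Nat.factorial ((L+1)/2) : ℂ))⁻¹ *
        ∑ σ : Equiv.Perm (Fin L), ∑ τ : Equiv.Perm (Fin (2*((L+1)/2))),
          (((Equiv.Perm.sign σ : ℤ) : ℂ) * ((Equiv.Perm.sign τ : ℤ) : ℂ)) *
            term hLn f σ τ a := by
    intro a
    rw [pf_T, ← Matrix.det_transpose, Matrix.det_apply']
    have : ∀ (X C T D I : ℂ), X * (C * T) * D * I = C * (D * (X * T * I)) := by intros; ring
    rw [this]
    congr 1
    rw [Finset.sum_mul]
    refine Finset.sum_congr rfl fun σ _ => ?_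
    rw [Finset.mul_sum, Finset.sum_mul, Finset.mul_sum]
    refine Finset.sum_congr rfl fun τ _ => ?_
    unfold term
    rw [prod_fext hLn hn]
    simp only [hfdef, Finset.prod_mul_distrib, Matrix.transpose_apply, Matrix.of_apply]
    ring
  simp_rw [hpt]
  rw [integral_const_mul, integral_finsetSum _ (fun σ _ => integrable_finsetSum _ (fun τ _ =>
    (term_integrable hLn f hf σ τ).const_mul _))]
  have hσ : ∀ σ : Equiv.Perm (Fin L), ∫ a, ∑ τ : Equiv.Perm (Fin (2*((L+1)/2))),
          (((Equiv.Perm.sign σ : ℤ) : ℂ) * ((Equiv.Perm.sign τ : ℤ) : ℂ)) *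
            term hLn f σ τ a = ∑ τ : Equiv.Perm (Fin (2*((L+1)/2))),
            ((Equiv.Perm.sign τ : ℤ) : ℂ) * ∏ j : Fin ((L+1)/2),
      Rk f (τ ⟨2*(j:ℕ), by have := j.isLt; omega⟩)
        (τ ⟨2*(j:ℕ)+1, by have := j.isLt; omega⟩) := by
    intro σ
    rw [integral_finsetSum _ (fun τ _ => (term_integrable hLn f hf σ τ).const_mul _)]
    conv_rhs => rw [← Equiv.sum_comp (Equiv.mulLeft (hatσ hLn σ))]
    refine Finset.sum_congr rfl fun τ _ => ?_
    rw [integral_const_mul, term_integral hLn hn]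
    simp only [Equiv.coe_mulLeft, Equiv.Perm.sign_mul, hatσ_sign]
    push_cast
    rfl
  simp_rw [hσ]
  rw [Finset.sum_const, Finset.card_univ, Fintype.card_perm, Fintype.card_fin, nsmul_eq_mul]
  unfold pf
  have : ((Nat.factorial L : ℕ) : ℂ) ≠ 0 := by exact_mod_cast Nat.factorial_ne_zero L
  field_simp

lemma pf_congr {K : Type*} [Field K] {J J' : ℕ} (hJ : J = J')
    (U : Matrix (Fin (2*J)) (Fin (2*J)) K) (U' : Matrix (Fin (2*J')) (Fin (2*J')) K)
    (hU : ∀ i j, U i j = U' (Fin.cast (by omega) i) (Fin.cast (by omega) j)) : pf U = pf U' := by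
  subst hJ
  congr 1
  ext i j
  exact hU i j

lemma emb_val {N L m n : ℕ} (s : Finset (Fin N)) (hLN : L ≤ N) (hNm : N ≤ m)
    (hm : m = N ∨ m = N + 1) (hLn : n + N = m + L)
    (h1 : (sᶜ).card = L) (h2 : ((s.image (Fin.castLE hNm))ᶜ).card = n) (j : Fin n) :
    (((s.image (Fin.castLE hNm))ᶜ).orderEmbOfFin h2 j : ℕ) =
      if hj : (j:ℕ) < L then (sᶜ.orderEmbOfFin h1 ⟨j, hj⟩ : ℕ) else N := by
  let g : Fin n → Fin m := fun j => if hj : (j:ℕ) < L then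
    Fin.castLE hNm (sᶜ.orderEmbOfFin h1 ⟨j, hj⟩) else ⟨N, by omega⟩
  have hg : g = ((s.image (Fin.castLE hNm))ᶜ).orderEmbOfFin h2 := by
    apply Finset.orderEmbOfFin_unique
    · intro x
      simp only [g, Finset.mem_compl, Finset.mem_image, not_exists, not_and]
      intro y hy hxy
      split_ifs at hxy with hx
      · have := Finset.orderEmbOfFin_mem sᶜ h1 ⟨x, hx⟩
        rw [← Fin.castLE_injective _ hxy] at this
        exact (Finset.mem_compl.1 this) hy
      · have := congrArg Fin.val hxy
        simp at this
        omega
    · intro x y hxy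
      have hxy' : (x:ℕ) < y := hxy
      simp only [g]
      by_cases hy : (y:ℕ) < L
      · have hx : (x:ℕ) < L := by omega
        rw [dif_pos hx, dif_pos hy]
        exact (sᶜ.orderEmbOfFin h1).strictMono (show (⟨x, hx⟩ : Fin L) < ⟨y, hy⟩ from hxy)
      · have hx : (x:ℕ) < L := by omega
        rw [dif_pos hx, dif_neg hy, Fin.lt_def]
        simp
  rw [← hg]
  simp only [g]
  split_ifs <;> rfl

/-- **Lemma 7 (Sinclair).**  For every `t ∈ I_{2M}^N` (encoded by its image, the
`2M`-element subset `s` of `{0,…,N−1}`, with `t' = sᶜ.orderEmbOfFin` and `t_∘` the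
corresponding subset of `{0,…,2J−1}`),
`(1/L!) ∫_{ℝ^L} {∏ φ(α_ℓ)} Pf T^α det W^α_{i',t'} dλ_L(α) = Pf R_{t_∘'}`,
assuming all integrals involved converge absolutely. -/
theorem real_integral_eq_pfaffian_minor (N L M : ℕ) (hN : 1 ≤ N) (h : L + 2*M = N)
    (ψ : ℂ → ℝ) (P : ℕ → Polynomial ℂ)
    (hP : ∀ n < N, (P n).Monic ∧ (P n).natDegree = n)
    (s : Finset (Fin N)) (hs : s.card = 2*M)
    (hInt : Integrable (fun a : Fin L → ℝ =>
      (∏ ℓ : Fin L, phi ψ ((a ℓ : ℝ) : ℂ)) * ((pf (Tmat a) : ℝ) : ℂ) *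
        Matrix.det (Matrix.of fun j k : Fin L =>
          (P ((sᶜ.orderEmbOfFin
              (by rw [Finset.card_compl, Fintype.card_fin, hs]; omega) k : Fin N) : ℕ)).eval
            ((a j : ℝ) : ℂ))))
    (hIntR : ∀ p < N, ∀ q < N, Integrable (fun a : ℝ × ℝ =>
      phi ψ (a.1 : ℂ) * phi ψ (a.2 : ℂ) * (P p).eval (a.1 : ℂ) * (P q).eval (a.2 : ℂ) *
        ((Real.sign (a.2 - a.1) : ℝ) : ℂ)))
    (hInt1 : ∀ p < N, Integrable (fun a : ℝ => phi ψ (a:ℂ) * (P p).eval (a:ℂ))) :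
    ((Nat.factorial L : ℕ) : ℂ)⁻¹ *
      (∫ a : Fin L → ℝ,
        (∏ ℓ : Fin L, phi ψ ((a ℓ : ℝ) : ℂ)) * ((pf (Tmat a) : ℝ) : ℂ) *
          Matrix.det (Matrix.of fun j k : Fin L =>
            (P ((sᶜ.orderEmbOfFin
                (by rw [Finset.card_compl, Fintype.card_fin, hs]; omega) k : Fin N) : ℕ)).eval
              ((a j : ℝ) : ℂ)))
      = pf (fun j k : Fin (2*((N+1)/2 - M)) =>
          Rmat N ψ P
            (((s.image (Fin.castLE (by omega : N ≤ 2*((N+1)/2))))ᶜ).orderEmbOfFin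
              (by
                rw [Finset.card_compl, Fintype.card_fin,
                  Finset.card_image_of_injective _ (Fin.castLE_injective _), hs]
                omega) j)
            (((s.image (Fin.castLE (by omega : N ≤ 2*((N+1)/2))))ᶜ).orderEmbOfFin
              (by
                rw [Finset.card_compl, Fintype.card_fin,
                  Finset.card_image_of_injective _ (Fin.castLE_injective _), hs]
                omega) k)) := by
  have hLc : (sᶜ).card = L := by rw [Finset.card_compl, Fintype.card_fin, hs]; omega
  have hlt : ∀ k, ((sᶜ.orderEmbOfFin hLc k : Fin N) : ℕ) < N := fun k => Fin.is_lt _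
  have hcore := core L (fun x => phi ψ (x:ℂ))
    (fun k x => (P ((sᶜ.orderEmbOfFin hLc k : Fin N) : ℕ)).eval (x:ℂ))
    (fun k => hInt1 _ (hlt k))
  refine hcore.trans ?_
  apply pf_congr (by omega)
  intro i j
  have hI : ∫ x, (Set.Icc (0:ℝ) 1).indicator (1 : ℝ → ℂ) x = 1 := by
    rw [integral_indicator measurableSet_Icc]; simp
  have E := fun i => emb_val (m := 2*((N+1)/2)) (n := 2*((N+1)/2 - M)) s (by omega : L ≤ N)
    (by omega) (by omega) (by omega) hLc
    (by
      rw [Finset.card_compl, Fintype.card_fin,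
        Finset.card_image_of_injective _ (Fin.castLE_injective _), hs]
      omega) i
  unfold Rmat Rk
  simp only [E, Fin.val_cast]
  by_cases hi : (i:ℕ) < L <;> by_cases hj : (j:ℕ) < L
  · simp only [hi, hj, dif_pos, hlt, and_self, if_true, innerR, fext, Sk]
    congr 1
    ext a
    ring
  · have hjL : (j:ℕ) = L := by omega
    have e1 : Real.sign ((L:ℝ) - ((i:ℕ):ℝ)) = 1 :=
      Real.sign_of_pos (by rw [sub_pos]; exact_mod_cast hi)
    have e2 : Real.sign ((N:ℝ) - (((sᶜ.orderEmbOfFin hLc ⟨i, hi⟩ : Fin N) : ℕ):ℝ)) = 1 :=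
      Real.sign_of_pos (by rw [sub_pos]; exact_mod_cast hlt _)
    simp only [hi, hjL, dif_pos, lt_irrefl, and_false, if_false, fext, Sk, dif_neg,
      not_false_eq_true, e1, e2, min_eq_left (hlt _).le, Complex.ofReal_one, mul_one, one_mul]
    have hF := integral_prod_mul (μ := (volume : Measure ℝ)) (ν := (volume : Measure ℝ))
      (fun x : ℝ => phi ψ (x:ℂ) * (P ((sᶜ.orderEmbOfFin hLc ⟨i, hi⟩ : Fin N) : ℕ)).eval (x:ℂ))
      ((Set.Icc (0:ℝ) 1).indicator (1 : ℝ → ℂ))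
    rw [hI, mul_one] at hF
    exact hF
  · have hiL : (i:ℕ) = L := by omega
    have e1 : Real.sign (((j:ℕ):ℝ) - (L:ℝ)) = -1 :=
      Real.sign_of_neg (by rw [sub_neg]; exact_mod_cast hj)
    have e2 : Real.sign ((((sᶜ.orderEmbOfFin hLc ⟨j, hj⟩ : Fin N) : ℕ):ℝ) - (N:ℝ)) = -1 :=
      Real.sign_of_neg (by rw [sub_neg]; exact_mod_cast hlt _)
    simp only [hj, hiL, dif_pos, lt_irrefl, false_and, if_false, fext, Sk, dif_neg,
      not_false_eq_true, e1, e2, min_eq_right (hlt _).le]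
    have hF := integral_prod_mul (μ := (volume : Measure ℝ)) (ν := (volume : Measure ℝ))
      ((Set.Icc (0:ℝ) 1).indicator (1 : ℝ → ℂ))
      (fun x : ℝ => phi ψ (x:ℂ) * (P ((sᶜ.orderEmbOfFin hLc ⟨j, hj⟩ : Fin N) : ℕ)).eval (x:ℂ))
    rw [hI, one_mul] at hF
    rw [integral_mul_const, mul_comm]
    exact congrArg _ hF
  · have hiL : (i:ℕ) = L := by omega
    have hjL : (j:ℕ) = L := by omega
    simp [hiL, hjL, Sk, Real.sign_zero]

end
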